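/- Let I ⊆ K[x_0, x_1, x_2] be the radical ideal of n ≥ 5 distinct points lying on a smooth conic C in P^2, where n is odd. Then I^{(2r−1)} ⊆ M^{r−1} I^r for every integer r ≥ 1. -/

import Mathlib

open MvPolynomial

noncomputable section

/-- The ideal generated by all homogeneous forms vanishing at the point with
coordinate vector `p`. -/
def homVanishingIdeal {K σ : Type*} [Field K] (p : σ → K) : Ideal (MvPolynomial σ K) :=
  Ideal.span {F : MvPolynomial σ K | (∃ d, F.IsHomogeneous d) ∧ MvPolynomial.eval p F = 0}

/-- The `m`-th symbolic power of the radical ideal of the finite set of points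
with coordinate vectors `P i`: the intersection of the `m`-th powers of the
ideals of the individual points. -/
def symbPow {K σ ι : Type*} [Field K] (P : ι → σ → K) (m : ℕ) : Ideal (MvPolynomial σ K) :=
  ⨅ i, homVanishingIdeal (P i) ^ m

/-- The irrelevant maximal ideal `M = (x_0, …, x_N)`. -/
def irrel (K σ : Type*) [Field K] : Ideal (MvPolynomial σ K) :=
  Ideal.span (Set.range (MvPolynomial.X : σ → MvPolynomial σ K))

/-- The coordinate vectors `P i` are nonzero and represent pairwise distinct
points of projective space (no two are proportional). -/
def ProjectivelyDistinct {K σ ι : Type*} [Field K] (P : ι → σ → K) : Prop :=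
  (∀ i, P i ≠ 0) ∧ Pairwise fun i j => ∀ c : K, P i ≠ c • P j

/-- `α(J)`: the least degree of a nonzero homogeneous element of `J`. -/
def idealAlpha {K σ : Type*} [Field K] (J : Ideal (MvPolynomial σ K)) : ℕ :=
  sInf {d : ℕ | ∃ F ∈ J, F ≠ 0 ∧ MvPolynomial.IsHomogeneous F d}

section Point

variable {K σ : Type*} [Field K]

/-- Restriction of a polynomial to the line through the origin spanned by `p`. -/
def lineRestrict (p : σ → K) : MvPolynomial σ K →ₐ[K] Polynomial K :=
  aeval fun i => Polynomial.C (p i) * Polynomial.X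

theorem lineRestrict_X (p : σ → K) (i : σ) :
    lineRestrict p (X i) = Polynomial.C (p i) * Polynomial.X := aeval_X _ _

theorem eval_one_lineRestrict (p : σ → K) (F : MvPolynomial σ K) :
    (lineRestrict p F).eval 1 = eval p F := by
  have : (Polynomial.aeval (1 : K)).comp (lineRestrict p) = aeval p := by
    ext i; simp [lineRestrict_X]
  rw [← aeval_eq_eval, ← Polynomial.coe_aeval_eq_eval]
  exact DFunLike.congr_fun this F

theorem lineRestrict_of_isHomogeneous (p : σ → K) {F : MvPolynomial σ K} {d : ℕ}
    (hF : F.IsHomogeneous d) :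
    lineRestrict p F = Polynomial.C (eval p F) * Polynomial.X ^ d := by
  induction hF using IsWeightedHomogeneous.induction_on with
  | zero => simp
  | add F G _ _ hF hG => simp [hF, hG, add_mul]
  | monomial m r hm =>
    have hm' : m.degree = d := by rw [← hm, Finsupp.degree_eq_weight_one]; rfl
    subst hm'
    rw [lineRestrict, aeval_monomial, eval_monomial]
    simp only [mul_pow, Finsupp.prod, Finset.prod_mul_distrib, Finset.prod_pow_eq_pow_sum,
      Polynomial.algebraMap_eq, map_mul, map_prod, map_pow, Finsupp.degree_apply, mul_assoc]

theorem homVanishingIdeal_eq_ker (p : σ → K) {j : σ} (hj : p j ≠ 0) :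
    homVanishingIdeal p = RingHom.ker (lineRestrict p) ∧
    homVanishingIdeal p = Ideal.span (Set.range fun i => C (p j) * X i - C (p i) * X j) := by
  have h1 : homVanishingIdeal p ≤ RingHom.ker (lineRestrict p) := by
    refine Ideal.span_le.2 ?_
    rintro F ⟨⟨d, hd⟩, h0⟩
    simp [RingHom.mem_ker, lineRestrict_of_isHomogeneous p hd, h0]
  have h2 : Ideal.span (Set.range fun i => C (p j) * X i - C (p i) * X j) ≤
      homVanishingIdeal p := by
    refine Ideal.span_le.2 ?_
    rintro _ ⟨i, rfl⟩
    refine Ideal.subset_span ⟨⟨1, ?_⟩, ?_⟩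
    · exact (isHomogeneous_C_mul_X _ _).sub (isHomogeneous_C_mul_X _ _)
    · simp [mul_comm]
  have h3 : RingHom.ker (lineRestrict p) ≤
      Ideal.span (Set.range fun i => C (p j) * X i - C (p i) * X j) := by
    intro F hF
    set J := Ideal.span (Set.range fun i => C (p j) * X i - C (p i) * X j) with hJ
    have key : ((Ideal.Quotient.mkₐ K J).comp (Polynomial.aeval (C (p j)⁻¹ * X j))).comp
        (lineRestrict p) = Ideal.Quotient.mkₐ K J := by
      ext i
      simp only [AlgHom.comp_apply, lineRestrict_X, map_mul, Polynomial.aeval_C,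
        Polynomial.aeval_X]
      rw [← map_mul, ← map_mul]
      symm
      refine Ideal.Quotient.eq.2 ?_
      have : (X i - algebraMap K _ (p i) * (C (p j)⁻¹ * X j) : MvPolynomial σ K) =
          C (p j)⁻¹ * (C (p j) * X i - C (p i) * X j) := by
        rw [mul_sub, ← mul_assoc (C (p j)⁻¹) (C (p j)), ← C_mul, inv_mul_cancel₀ hj,
          algebraMap_eq, C_1]
        ring
      rw [this]
      exact Ideal.mul_mem_left _ _ (Ideal.subset_span ⟨i, rfl⟩)
    have := DFunLike.congr_fun key F
    rw [AlgHom.comp_apply, RingHom.mem_ker.1 hF, map_zero] at this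
    exact Ideal.Quotient.eq_zero_iff_mem.1 this.symm
  exact ⟨le_antisymm h1 (h3.trans h2), le_antisymm (h1.trans h3) h2⟩

theorem mem_homVanishingIdeal_iff {p : σ → K} (hp : p ≠ 0) {F : MvPolynomial σ K} :
    F ∈ homVanishingIdeal p ↔ lineRestrict p F = 0 := by
  obtain ⟨j, hj⟩ := Function.ne_iff.1 hp
  rw [(homVanishingIdeal_eq_ker p hj).1, RingHom.mem_ker]

theorem eval_eq_zero_of_mem_homVanishingIdeal {p : σ → K} {F : MvPolynomial σ K}
    (hp : p ≠ 0) (hF : F ∈ homVanishingIdeal p) : eval p F = 0 := by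
  rw [← eval_one_lineRestrict, (mem_homVanishingIdeal_iff hp).1 hF, Polynomial.eval_zero]

/-- The graded pieces of the expansion of a polynomial around a point `p` lie in the
corresponding powers of the ideal of `p`. -/
theorem exists_expansion {p : σ → K} (hp : p ≠ 0) :
    ∃ ψ : MvPolynomial σ K →ₐ[K] Polynomial (MvPolynomial σ K),
      ∀ m F, F ∈ homVanishingIdeal p ^ m ↔ Polynomial.X ^ m ∣ ψ F := by
  obtain ⟨j, hj⟩ := Function.ne_iff.1 hp
  obtain ⟨-, hspan⟩ := homVanishingIdeal_eq_ker p hj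
  set J := homVanishingIdeal p
  let c : σ → K := fun i => (p j)⁻¹ * p i
  have hc : ∀ i, (X i - C (c i) * X j : MvPolynomial σ K) =
      C (p j)⁻¹ * (C (p j) * X i - C (p i) * X j) := fun i => by
    rw [mul_sub, ← mul_assoc, ← C_mul, inv_mul_cancel₀ hj, C_1, ← mul_assoc, ← C_mul]; ring
  let ψ : MvPolynomial σ K →ₐ[K] Polynomial (MvPolynomial σ K) :=
    aeval fun i => Polynomial.C (C (c i) * X j) +
      Polynomial.monomial 1 (X i - C (c i) * X j)
  have hψX : ∀ i, ψ (X i) = Polynomial.C (C (c i) * X j) +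
      Polynomial.monomial 1 (X i - C (c i) * X j) := fun i => aeval_X _ _
  have hψC : ∀ a, ψ (C a) = Polynomial.C (C a) := fun a => ψ.commutes a
  have hmem : ∀ F, ψ F ∈ reesAlgebra J := by
    intro F
    induction F using MvPolynomial.induction_on with
    | C a => rw [hψC]; exact (reesAlgebra J).algebraMap_mem _
    | add F G hF hG => rw [map_add]; exact add_mem hF hG
    | mul_X F i hF =>
      rw [map_mul]
      refine mul_mem hF ?_
      rw [hψX]
      refine add_mem ((reesAlgebra J).algebraMap_mem _) (reesAlgebra.monomial_mem.2 ?_)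
      rw [pow_one, hc, hspan]
      exact Ideal.mul_mem_left _ _ (Ideal.subset_span ⟨i, rfl⟩)
  have heval : ∀ F, (ψ F).eval 1 = F := by
    intro F
    induction F using MvPolynomial.induction_on with
    | C a => simp [hψC]
    | add F G hF hG => rw [map_add, Polynomial.eval_add, hF, hG]
    | mul_X F i hF => rw [map_mul, Polynomial.eval_mul, hF, hψX]; simp
  have hJ : J.map (ψ : MvPolynomial σ K →+* Polynomial (MvPolynomial σ K)) ≤
      Ideal.span {Polynomial.X} := by
    rw [hspan, Ideal.map_span, Ideal.span_le]
    rintro _ ⟨_, ⟨i, rfl⟩, rfl⟩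
    refine Ideal.mem_span_singleton.2 ⟨Polynomial.C (C (p j) * X i - C (p i) * X j), ?_⟩
    have h1 : c j = 1 := inv_mul_cancel₀ hj
    have h2 : p j * c i = p i := mul_inv_cancel_left₀ hj _
    have h3 : (C (p i) : MvPolynomial σ K) = C (p j) * C (c i) := by rw [← C_mul, h2]
    simp only [RingHom.coe_coe, map_sub, map_mul, hψX, hψC, h1, h3,
      ← Polynomial.C_mul_X_eq_monomial, map_one]
    ring
  refine ⟨ψ, fun m F => ⟨fun hF => ?_, fun hF => ?_⟩⟩
  · have := Ideal.mem_map_of_mem (ψ : MvPolynomial σ K →+* Polynomial (MvPolynomial σ K)) hF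
    rw [Ideal.map_pow] at this
    have := Ideal.pow_right_mono hJ m this
    rwa [Ideal.span_singleton_pow, Ideal.mem_span_singleton] at this
  · rw [← heval F, Polynomial.eval_eq_sum, Polynomial.sum_def]
    refine Ideal.sum_mem _ fun a _ => ?_
    rw [one_pow, mul_one]
    rcases lt_or_ge a m with h | h
    · rw [Polynomial.X_pow_dvd_iff.1 hF a h]; exact zero_mem _
    · exact Ideal.pow_le_pow_right h (hmem F a)

theorem mem_pow_of_mul_mem_pow_succ {p : σ → K} (hp : p ≠ 0) {Q S : MvPolynomial σ K}
    (hQ : Q ∉ homVanishingIdeal p ^ 2) (hQ1 : Q ∈ homVanishingIdeal p) {m : ℕ}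
    (h : Q * S ∈ homVanishingIdeal p ^ (m + 1)) : S ∈ homVanishingIdeal p ^ m := by
  obtain ⟨ψ, hψ⟩ := exists_expansion hp
  rw [hψ] at hQ h ⊢
  rw [← pow_one (homVanishingIdeal p), hψ, pow_one] at hQ1
  obtain ⟨q, hq⟩ := hQ1
  rw [map_mul, hq, pow_succ', mul_assoc] at h
  have h' := (mul_dvd_mul_iff_left Polynomial.X_ne_zero).1 h
  refine Polynomial.prime_X.pow_dvd_of_dvd_mul_left _ (fun hd => hQ ?_) h'
  rw [hq, pow_two]
  exact mul_dvd_mul_left _ hd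

theorem pderiv_mem_of_mem_sq {J : Ideal (MvPolynomial σ K)} {F : MvPolynomial σ K}
    (hF : F ∈ J ^ 2) (i : σ) : pderiv i F ∈ J := by
  rw [pow_two] at hF
  refine Submodule.mul_induction_on hF (fun a ha b hb => ?_) fun a b ha hb => ?_
  · rw [Derivation.leibniz]
    exact add_mem (Ideal.mul_mem_right _ _ ha) (Ideal.mul_mem_right _ _ hb)
  · rw [map_add]; exact add_mem ha hb

theorem mem_irrel_of_constantCoeff_eq_zero {F : MvPolynomial σ K} (h : constantCoeff F = 0) :
    F ∈ irrel K σ := by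
  have : ∀ G : MvPolynomial σ K, G - C (constantCoeff G) ∈ irrel K σ := by
    intro G
    induction G using MvPolynomial.induction_on with
    | C a => simp
    | add F G hF hG =>
      rw [map_add, map_add, add_sub_add_comm]; exact add_mem hF hG
    | mul_X F i hF =>
      have : X i ∈ irrel K σ := Ideal.subset_span ⟨i, rfl⟩
      simpa using Ideal.mul_mem_left _ F this
  simpa [h] using this F

end Point

section Veronese

variable {K : Type*} [Field K]

/-- The linear form on the projective line vanishing at `v`. -/
def pointForm (v : Fin 2 → K) : MvPolynomial (Fin 2) K := C (v 1) * X 0 - C (v 0) * X 1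

theorem span_pointForm {v : Fin 2 → K} (hv : v ≠ 0) :
    Ideal.span {pointForm v} = RingHom.ker (lineRestrict v) := by
  obtain ⟨j, hj⟩ := Function.ne_iff.1 hv
  obtain ⟨h1, h2⟩ := homVanishingIdeal_eq_ker v hj
  rw [← h1, h2]
  refine le_antisymm ?_ ?_
  · rw [Ideal.span_singleton_le_iff_mem]
    fin_cases j
    · have h : -pointForm v = C (v 0) * X 1 - C (v 1) * X 0 := by rw [pointForm]; ring
      rw [← Ideal.neg_mem_iff, h]
      exact Ideal.subset_span ⟨1, rfl⟩
    · exact Ideal.subset_span ⟨0, rfl⟩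
  · refine Ideal.span_le.2 ?_
    rintro _ ⟨i, rfl⟩
    refine Ideal.mem_span_singleton.2 ?_
    fin_cases j <;> fin_cases i
    · simp
    · exact ⟨-1, by simp only [pointForm, Fin.zero_eta, Fin.mk_one]; ring⟩
    · exact ⟨1, by simp only [pointForm, Fin.zero_eta, Fin.mk_one]; ring⟩
    · simp

theorem pointForm_dvd_iff {v : Fin 2 → K} (hv : v ≠ 0) {F : MvPolynomial (Fin 2) K} :
    pointForm v ∣ F ↔ lineRestrict v F = 0 := by
  rw [← Ideal.mem_span_singleton, span_pointForm hv, RingHom.mem_ker]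

theorem prime_pointForm {v : Fin 2 → K} (hv : v ≠ 0) : Prime (pointForm v) := by
  have h0 : pointForm v ≠ 0 := by
    intro h
    have h0 := congrArg (eval ![1, 0]) h
    have h1 := congrArg (eval ![0, 1]) h
    simp only [pointForm, map_sub, map_mul, eval_C, eval_X, map_zero, Matrix.cons_val_zero,
      Matrix.cons_val_one, mul_one, mul_zero, sub_zero, zero_sub, neg_eq_zero] at h0 h1
    exact hv (funext fun i => by fin_cases i <;> assumption)
  rw [← Ideal.span_singleton_prime h0, span_pointForm hv]
  exact RingHom.ker_isPrime _

/-- Polynomials all of whose monomials have even total degree. -/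
abbrev IsEvenPoly (F : MvPolynomial (Fin 2) K) : Prop :=
  IsWeightedHomogeneous (fun _ => (1 : ZMod 2)) F 0

theorem IsEvenPoly.of_mul_left {A g : MvPolynomial (Fin 2) K} (hA : IsEvenPoly A) (hA0 : A ≠ 0)
    (hAg : IsEvenPoly (A * g)) : IsEvenPoly g := by
  have hdec : ∀ g : MvPolynomial (Fin 2) K, ∃ g₀ g₁, IsEvenPoly g₀ ∧
      IsWeightedHomogeneous (fun _ => (1 : ZMod 2)) g₁ 1 ∧ g = g₀ + g₁ := by
    intro g
    induction g using MvPolynomial.induction_on' with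
    | monomial u a =>
      have h : ∀ z : ZMod 2, z = 0 ∨ z = 1 := by decide
      rcases h (Finsupp.weight (fun _ => (1 : ZMod 2)) u) with h | h
      · exact ⟨_, 0, isWeightedHomogeneous_monomial _ _ _ h, isWeightedHomogeneous_zero _ _ _,
          (add_zero _).symm⟩
      · exact ⟨0, _, isWeightedHomogeneous_zero _ _ _, isWeightedHomogeneous_monomial _ _ _ h,
          (zero_add _).symm⟩
    | add p q hp hq =>
      obtain ⟨p₀, p₁, hp₀, hp₁, rfl⟩ := hp
      obtain ⟨q₀, q₁, hq₀, hq₁, rfl⟩ := hq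
      exact ⟨p₀ + q₀, p₁ + q₁, hp₀.add hq₀, hp₁.add hq₁, by ring⟩
  obtain ⟨g₀, g₁, h₀, h₁, rfl⟩ := hdec g
  have hodd := hA.mul h₁
  have heven : IsEvenPoly (A * g₁) := by
    have := hAg.sub (by simpa using hA.mul h₀)
    rwa [mul_add, add_sub_cancel_left] at this
  have : A * g₁ = 0 := by
    by_contra hne
    exact absurd (IsWeightedHomogeneous.inj_right hne heven hodd) (by decide)
  rw [(mul_eq_zero.1 this).resolve_left hA0, add_zero]
  exact h₀

theorem isEvenPoly_pointForm_mul (v w : Fin 2 → K) :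
    IsEvenPoly (pointForm v * pointForm w) := by
  have h : ∀ v : Fin 2 → K, IsWeightedHomogeneous (fun _ => (1 : ZMod 2)) (pointForm v) 1 :=
    fun v => ((isWeightedHomogeneous_X K _ 0).C_mul _).sub ((isWeightedHomogeneous_X K _ 1).C_mul _)
  exact (h v).mul (h w)

/-- The parametrization of the conic `x₀ x₂ = x₁²`. -/
def veronese : MvPolynomial (Fin 3) K →ₐ[K] MvPolynomial (Fin 2) K :=
  aeval ![X 0 ^ 2, X 0 * X 1, X 1 ^ 2]

theorem veronese_C (a : K) : veronese (C a) = C a := veronese.commutes a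

theorem veronese_X_zero : veronese (X 0 : MvPolynomial (Fin 3) K) = X 0 ^ 2 := aeval_X _ _

theorem veronese_X_one : veronese (X 1 : MvPolynomial (Fin 3) K) = X 0 * X 1 := aeval_X _ _

theorem veronese_X_two : veronese (X 2 : MvPolynomial (Fin 3) K) = X 1 ^ 2 := aeval_X _ _

theorem isEvenPoly_veronese (F : MvPolynomial (Fin 3) K) : IsEvenPoly (veronese F) := by
  induction F using MvPolynomial.induction_on with
  | C a => rw [veronese_C]; exact isWeightedHomogeneous_C _ _
  | add F G hF hG => rw [map_add]; exact hF.add hG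
  | mul_X F i hF =>
    rw [map_mul]
    have hX : ∀ i j : Fin 2, IsEvenPoly (X i * X j : MvPolynomial (Fin 2) K) := fun i j =>
      (isWeightedHomogeneous_X K _ i).mul (isWeightedHomogeneous_X K _ j)
    suffices IsEvenPoly (veronese (X i : MvPolynomial (Fin 3) K)) by simpa using hF.mul this
    fin_cases i
    · exact veronese_X_zero (K := K) ▸ pow_two (X 0 : MvPolynomial (Fin 2) K) ▸ hX 0 0
    · exact veronese_X_one (K := K) ▸ hX 0 1
    · exact veronese_X_two (K := K) ▸ pow_two (X 1 : MvPolynomial (Fin 2) K) ▸ hX 1 1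

theorem exists_veronese_eq {g : MvPolynomial (Fin 2) K} (hg : IsEvenPoly g) :
    ∃ F, veronese F = g := by
  induction hg using IsWeightedHomogeneous.induction_on with
  | zero => exact ⟨0, map_zero _⟩
  | add p q _ _ hp hq =>
    obtain ⟨F, rfl⟩ := hp
    obtain ⟨G, rfl⟩ := hq
    exact ⟨F + G, map_add _ _ _⟩
  | monomial d r hd =>
    have hd' : Even (d 0 + d 1) := by
      rw [← ZMod.natCast_eq_zero_iff_even, ← hd, Finsupp.weight_apply,
        Finsupp.sum_fintype _ _ (by simp)]
      simp
    have hmon : monomial d r = C r * (X 0 ^ d 0 * X 1 ^ d 1) := by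
      rw [monomial_eq, Finsupp.prod_fintype _ _ (by simp), Fin.prod_univ_two]
    rw [hmon]
    rcases Nat.even_or_odd (d 0) with h0 | h0
    · obtain ⟨b, hb⟩ := (Nat.even_add.1 hd').1 h0
      obtain ⟨a, ha⟩ := h0
      refine ⟨C r * (X 0 ^ a * X 2 ^ b), ?_⟩
      simp only [map_mul, map_pow, veronese_C, veronese_X_zero, veronese_X_two, ha, hb]
      ring
    · have h1 : Odd (d 1) := by
        rw [← Nat.not_even_iff_odd] at h0 ⊢; exact fun h => h0 ((Nat.even_add.1 hd').2 h)
      obtain ⟨a, ha⟩ := h0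
      obtain ⟨b, hb⟩ := h1
      refine ⟨C r * (X 0 ^ a * X 1 * X 2 ^ b), ?_⟩
      simp only [map_mul, map_pow, veronese_C, veronese_X_zero, veronese_X_one, veronese_X_two,
        ha, hb]
      ring

theorem constantCoeff_veronese (F : MvPolynomial (Fin 3) K) :
    constantCoeff (veronese F) = constantCoeff F := by
  induction F using MvPolynomial.induction_on with
  | C a => rw [veronese_C]; simp
  | add F G hF hG => rw [map_add, map_add, map_add, hF, hG]
  | mul_X F i _ =>
    rw [map_mul, map_mul, map_mul, constantCoeff_X, mul_zero]
    fin_cases i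
    · simp [veronese_X_zero]
    · simp [veronese_X_one]
    · simp [veronese_X_two]

theorem veronese_expand {A B : MvPolynomial (Fin 2) K}
    (h : expand 2 A + X 0 * X 1 * expand 2 B = 0) : A = 0 ∧ B = 0 := by
  have hA : A = 0 := by
    ext m
    have hm := congrArg (coeff (2 • m)) h
    rw [coeff_add, coeff_expand_smul _ two_ne_zero, mul_assoc, coeff_X_mul', coeff_zero] at hm
    rw [coeff_zero, ← hm, left_eq_add]
    split_ifs with h0
    · rw [coeff_X_mul']
      split_ifs with h1
      · apply coeff_expand_of_not_dvd (i := 0)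
        have : (2 • m) 0 ≠ 0 := by simpa using h0
        simp only [Finsupp.coe_tsub, Pi.sub_apply, Finsupp.smul_apply, smul_eq_mul,
          Finsupp.single_apply] at *
        simp
        omega
      · rfl
    · rfl
  refine ⟨hA, ?_⟩
  rw [hA, map_zero, zero_add] at h
  have h' := (mul_eq_zero.1 h).resolve_left (mul_ne_zero (X_ne_zero _) (X_ne_zero _))
  exact (expand_eq_zero two_pos).1 h'

theorem dvd_of_veronese_eq_zero {F : MvPolynomial (Fin 3) K} (hF : veronese F = 0) :
    X 0 * X 2 - X 1 ^ 2 ∣ F := by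
  let ι : MvPolynomial (Fin 2) K →ₐ[K] MvPolynomial (Fin 3) K := aeval ![X 0, X 2]
  have hι0 : ι (X 0) = X 0 := aeval_X _ _
  have hι1 : ι (X 1) = X 2 := aeval_X _ _
  have hιC : ∀ a, ι (C a) = C a := fun a => ι.commutes a
  have hdec : ∀ F : MvPolynomial (Fin 3) K, ∃ A B G,
      F = ι A + X 1 * ι B + (X 0 * X 2 - X 1 ^ 2) * G := by
    intro F
    induction F using MvPolynomial.induction_on with
    | C a => exact ⟨C a, 0, 0, by simp [hιC]⟩
    | add F F' hF hF' =>
      obtain ⟨A, B, G, rfl⟩ := hF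
      obtain ⟨A', B', G', rfl⟩ := hF'
      exact ⟨A + A', B + B', G + G', by simp only [map_add]; ring⟩
    | mul_X F i hF =>
      obtain ⟨A, B, G, rfl⟩ := hF
      fin_cases i
      · exact ⟨A * X 0, B * X 0, G * X 0, by simp only [map_mul, hι0, Fin.zero_eta]; ring⟩
      · exact ⟨X 0 * X 1 * B, A, G * X 1 - ι B, by
          simp only [map_mul, hι0, hι1, Fin.mk_one]; ring⟩
      · exact ⟨A * X 1, B * X 1, G * X 2, by
          simp only [map_mul, hι1, Fin.reduceFinMk]; ring⟩
  have hcomp : ∀ A, veronese (ι A) = expand 2 A := by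
    intro A
    induction A using MvPolynomial.induction_on with
    | C a => rw [hιC, veronese_C, expand_C]
    | add F G hF hG => simp only [map_add, hF, hG]
    | mul_X F i hF =>
      rw [map_mul, map_mul, map_mul, hF, expand_X]
      fin_cases i
      · exact congrArg _ (by simp only [Fin.zero_eta, hι0, veronese_X_zero])
      · exact congrArg _ (by simp only [Fin.mk_one, hι1, veronese_X_two])
  obtain ⟨A, B, G, rfl⟩ := hdec F
  have hQ : veronese (X 0 * X 2 - X 1 ^ 2 : MvPolynomial (Fin 3) K) = 0 := by
    simp only [map_sub, map_mul, map_pow, veronese_X_zero, veronese_X_one, veronese_X_two]; ring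
  rw [map_add, map_add, map_mul, map_mul, hQ, zero_mul, add_zero, hcomp, hcomp,
    veronese_X_one] at hF
  obtain ⟨rfl, rfl⟩ := veronese_expand hF
  simp

theorem lineRestrict_veronese (v : Fin 2 → K) (F : MvPolynomial (Fin 3) K) :
    lineRestrict v (veronese F) =
      Polynomial.expand K 2 (lineRestrict ![v 0 ^ 2, v 0 * v 1, v 1 ^ 2] F) := by
  induction F using MvPolynomial.induction_on with
  | C a =>
    rw [veronese_C]
    simp [lineRestrict, ← algebraMap_eq, Polynomial.algebraMap_eq]
  | add F G hF hG => simp only [map_add, hF, hG]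
  | mul_X F i hF =>
    simp only [map_mul, hF]
    congr 1
    fin_cases i
    · simp [veronese_X_zero, lineRestrict_X]; ring
    · simp [veronese_X_one, lineRestrict_X]; ring
    · simp [veronese_X_two, lineRestrict_X]; ring

theorem exists_param_of_mem_conic [IsAlgClosed K] (p : Fin 3 → K) (hp : p 0 * p 2 = p 1 ^ 2) :
    ∃ v : Fin 2 → K, p = ![v 0 ^ 2, v 0 * v 1, v 1 ^ 2] := by
  obtain ⟨a, ha⟩ := IsAlgClosed.exists_pow_nat_eq (p 0) two_pos
  obtain ⟨b, hb⟩ := IsAlgClosed.exists_pow_nat_eq (p 2) two_pos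
  have h : (a * b) ^ 2 = p 1 ^ 2 := by rw [mul_pow, ha, hb, hp]
  rcases sq_eq_sq_iff_eq_or_eq_neg.1 h with h | h
  · refine ⟨![a, b], funext fun i => ?_⟩
    fin_cases i <;> simp [ha, hb, h]
  · refine ⟨![a, -b], funext fun i => ?_⟩
    fin_cases i <;> simp [ha, hb, h]

end Veronese

section NormalForm

open Matrix

variable {K : Type*} [Field K]

theorem exists_eq_smul_of_cross_eq_zero {u v : Fin 3 → K} (hu : u ≠ 0)
    (h : crossProduct u v = 0) : ∃ c : K, v = c • u := by
  by_contra hne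
  push Not at hne
  refine crossProduct_ne_zero_iff_linearIndependent.2 ?_ h
  exact (LinearIndependent.pair_iff' hu).2 fun a ha => hne a ha.symm

/-- A smooth ternary quadratic form `q` with gradient `G` and two isotropic points in distinct
directions is a multiple of `y₀ y₂ - y₁²` in suitable coordinates. -/
theorem exists_conic_coordinates (q : (Fin 3 → K) → K) (G : (Fin 3 → K) → Fin 3 → K)
    (hGself : ∀ x, G x ⬝ᵥ x = 2 * q x) (hsymm : ∀ u v, G u ⬝ᵥ v = G v ⬝ᵥ u)
    (hGsub : ∀ x y (c : K), G (x - c • y) = G x - c • G y)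
    (hqsum : ∀ u v w (α β γ : K), q (α • u + β • v + γ • w) =
      α ^ 2 * q u + β ^ 2 * q v + γ ^ 2 * q w + α * β * (G u ⬝ᵥ v) + α * γ * (G u ⬝ᵥ w) +
        β * γ * (G v ⬝ᵥ w))
    (hsm : ∀ x, x ≠ 0 → q x = 0 → G x ≠ 0)
    {p p' : Fin 3 → K} (hp0 : p ≠ 0) (hpp' : ∀ c : K, p' ≠ c • p) (hp : q p = 0)
    (hp' : q p' = 0) :
    ∃ (M : Matrix (Fin 3) (Fin 3) K) (k : K), M.det ≠ 0 ∧ k ≠ 0 ∧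
      ∀ y, q (M *ᵥ y) = k * (y 0 * y 2 - y 1 ^ 2) := by
  have hp'0 : p' ≠ 0 := fun h => hpp' 0 (by rw [h, zero_smul])
  set w := crossProduct (G p) (G p') with hw
  set b := G p ⬝ᵥ p' with hb
  have hpp : G p ⬝ᵥ p = 0 := by rw [hGself, hp, mul_zero]
  have hpp₂ : G p' ⬝ᵥ p' = 0 := by rw [hGself, hp', mul_zero]
  have hp₂p : G p' ⬝ᵥ p = b := hsymm _ _
  have hpw : G p ⬝ᵥ w = 0 := dot_self_cross _ _
  have hp₂w : G p' ⬝ᵥ w = 0 := dot_cross_self _ _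
  have hb0 : b ≠ 0 := by
    intro hb0
    have hw0 : w = 0 := by
      by_contra hw0
      have h1 : crossProduct w p = 0 := by
        rw [hw, cross_cross_eq_smul_sub_smul, hp₂p, hpp, hb0]; simp
      have h2 : crossProduct w p' = 0 := by
        rw [hw, cross_cross_eq_smul_sub_smul, hpp₂, ← hb, hb0]; simp
      obtain ⟨c, hc⟩ := exists_eq_smul_of_cross_eq_zero hw0 h1
      obtain ⟨c', hc'⟩ := exists_eq_smul_of_cross_eq_zero hw0 h2
      have hc0 : c ≠ 0 := by rintro rfl; exact hp0 (by rw [hc, zero_smul])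
      refine hpp' (c' / c) ?_
      rw [hc, smul_smul, div_mul_cancel₀ _ hc0, hc']
    obtain ⟨c, hc⟩ := exists_eq_smul_of_cross_eq_zero (hsm p hp0 hp) hw0
    refine hsm (p' - c • p) (fun h => hpp' c (sub_eq_zero.1 h)) ?_ ?_
    · have := hqsum p p' 0 (-c) 1 0
      rw [hp, hp', ← hb, hb0] at this
      simpa [sub_eq_neg_add] using this
    · rw [hGsub, hc, sub_self]
  have hw0 : w ≠ 0 := by
    intro hw0
    obtain ⟨c, hc⟩ := exists_eq_smul_of_cross_eq_zero (hsm p hp0 hp) hw0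
    rw [hc, smul_dotProduct, hpp, smul_zero] at hp₂p
    exact hb0 hp₂p.symm
  let M : K → Matrix (Fin 3) (Fin 3) K := fun s => .of fun i => ![s * p i, w i, p' i]
  have hM : ∀ s y, M s *ᵥ y = (s * y 0) • p + y 1 • w + y 2 • p' := by
    intro s y
    ext i
    simp only [M, mulVec, dotProduct, Fin.sum_univ_three, of_apply, cons_val, Pi.add_apply,
      Pi.smul_apply, smul_eq_mul]
    ring
  have hdet : ∀ s ≠ 0, (M s).det ≠ 0 := by
    intro s hs h
    obtain ⟨y, hy, hMy⟩ := exists_mulVec_eq_zero_iff.2 h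
    rw [hM] at hMy
    have h2 := congrArg (G p ⬝ᵥ ·) hMy
    have h0 := congrArg (G p' ⬝ᵥ ·) hMy
    simp only [dotProduct_add, dotProduct_smul, hpp, hpw, hp₂p, hp₂w, hpp₂, ← hb, smul_eq_mul,
      dotProduct_zero, mul_zero, add_zero, zero_add, mul_eq_zero, hb0, hs, or_false,
      false_or] at h0 h2
    rw [h0, h2, mul_zero, zero_smul, zero_smul, zero_add, add_zero, smul_eq_zero] at hMy
    refine hy (funext fun i => ?_)
    fin_cases i
    exacts [h0, hMy.resolve_right hw0, h2]
  have hqw : q w ≠ 0 := by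
    intro hqw
    refine hdet 1 one_ne_zero (exists_vecMul_eq_zero_iff.1 ⟨G w, hsm w hw0 hqw, ?_⟩)
    have h0 : G w ⬝ᵥ p = 0 := by rw [hsymm, hpw]
    have h1 : G w ⬝ᵥ w = 0 := by rw [hGself, hqw, mul_zero]
    have h2 : G w ⬝ᵥ p' = 0 := by rw [hsymm, hp₂w]
    ext i
    fin_cases i
    · simpa [M, vecMul, dotProduct] using h0
    · simpa [M, vecMul, dotProduct] using h1
    · simpa [M, vecMul, dotProduct] using h2
  refine ⟨M (-q w / b), -q w, hdet _ (div_ne_zero (neg_ne_zero.2 hqw) hb0), neg_ne_zero.2 hqw,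
    fun y => ?_⟩
  rw [hM, hqsum, hp, hp', hpw, ← hb, hsymm w p', hp₂w]
  field_simp
  ring

theorem exists_coeffs_of_isHomogeneous_two {Q : MvPolynomial (Fin 3) K}
    (hQ : Q.IsHomogeneous 2) : ∃ a b c d e f : K,
      Q = C a * X 0 ^ 2 + C b * X 1 ^ 2 + C c * X 2 ^ 2 + C d * (X 1 * X 2) +
        C e * (X 0 * X 2) + C f * (X 0 * X 1) := by
  induction hQ using IsWeightedHomogeneous.induction_on with
  | zero => exact ⟨0, 0, 0, 0, 0, 0, by simp⟩
  | add P Q _ _ hP hQ =>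
    obtain ⟨a, b, c, d, e, f, rfl⟩ := hP
    obtain ⟨a', b', c', d', e', f', rfl⟩ := hQ
    exact ⟨a + a', b + b', c + c', d + d', e + e', f + f', by simp only [C_add]; ring⟩
  | monomial m r hm =>
    have hsum : m 0 + m 1 + m 2 = 2 := by
      rw [Finsupp.weight_apply, Finsupp.sum_fintype _ _ (by simp), Fin.sum_univ_three] at hm
      simpa using hm
    have hmon : monomial m r = C r * (X 0 ^ m 0 * X 1 ^ m 1 * X 2 ^ m 2) := by
      rw [monomial_eq, Finsupp.prod_fintype _ _ (by simp), Fin.prod_univ_three]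
    rw [hmon]
    obtain ⟨h0, h1, h2⟩ | ⟨h0, h1, h2⟩ | ⟨h0, h1, h2⟩ | ⟨h0, h1, h2⟩ | ⟨h0, h1, h2⟩ |
        ⟨h0, h1, h2⟩ : (m 0 = 2 ∧ m 1 = 0 ∧ m 2 = 0) ∨ (m 0 = 0 ∧ m 1 = 2 ∧ m 2 = 0) ∨
        (m 0 = 0 ∧ m 1 = 0 ∧ m 2 = 2) ∨ (m 0 = 0 ∧ m 1 = 1 ∧ m 2 = 1) ∨
        (m 0 = 1 ∧ m 1 = 0 ∧ m 2 = 1) ∨ (m 0 = 1 ∧ m 1 = 1 ∧ m 2 = 0) := by omega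
    all_goals rw [h0, h1, h2]
    · exact ⟨r, 0, 0, 0, 0, 0, by simp⟩
    · exact ⟨0, r, 0, 0, 0, 0, by simp⟩
    · exact ⟨0, 0, r, 0, 0, 0, by simp⟩
    · exact ⟨0, 0, 0, r, 0, 0, by simp⟩
    · exact ⟨0, 0, 0, 0, r, 0, by simp⟩
    · exact ⟨0, 0, 0, 0, 0, r, by simp⟩

theorem exists_conic_matrix {Q : MvPolynomial (Fin 3) K} (hQ : Q.IsHomogeneous 2)
    (hsm : ∀ p : Fin 3 → K, p ≠ 0 → eval p Q = 0 → ∃ i, eval p (pderiv i Q) ≠ 0)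
    {p p' : Fin 3 → K} (hp0 : p ≠ 0) (hpp' : ∀ c : K, p' ≠ c • p) (hp : eval p Q = 0)
    (hp' : eval p' Q = 0) :
    ∃ (M : Matrix (Fin 3) (Fin 3) K) (k : K), M.det ≠ 0 ∧ k ≠ 0 ∧
      ∀ y, eval (M *ᵥ y) Q = k * (y 0 * y 2 - y 1 ^ 2) := by
  obtain ⟨a, b, c, d, e, f, rfl⟩ := exists_coeffs_of_isHomogeneous_two hQ
  set Q : MvPolynomial (Fin 3) K := C a * X 0 ^ 2 + C b * X 1 ^ 2 + C c * X 2 ^ 2 +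
    C d * (X 1 * X 2) + C e * (X 0 * X 2) + C f * (X 0 * X 1) with hQdef
  have hq : ∀ x, eval x Q = a * x 0 ^ 2 + b * x 1 ^ 2 + c * x 2 ^ 2 + d * (x 1 * x 2) +
      e * (x 0 * x 2) + f * (x 0 * x 1) := fun x => by
    simp only [hQdef, map_add, map_mul, map_pow, eval_C, eval_X]
  have hG0 : ∀ x, eval x (pderiv 0 Q) = 2 * a * x 0 + e * x 2 + f * x 1 := fun x => by
    simp [hQdef, pderiv_X, Derivation.leibniz]; ring
  have hG1 : ∀ x, eval x (pderiv 1 Q) = 2 * b * x 1 + d * x 2 + f * x 0 := fun x => by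
    simp [hQdef, pderiv_X, Derivation.leibniz]; ring
  have hG2 : ∀ x, eval x (pderiv 2 Q) = 2 * c * x 2 + d * x 1 + e * x 0 := fun x => by
    simp [hQdef, pderiv_X, Derivation.leibniz]; ring
  refine exists_conic_coordinates (fun x => eval x Q) (fun x i => eval x (pderiv i Q))
    (fun x => ?_) (fun u v => ?_) (fun x y s => ?_) (fun u v w α β γ => ?_) (fun x hx h0 hG => ?_)
    hp0 hpp' hp hp'
  · simp only [dotProduct, Fin.sum_univ_three, hq, hG0, hG1, hG2]; ring
  · simp only [dotProduct, Fin.sum_univ_three, hG0, hG1, hG2]; ring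
  · ext i
    fin_cases i <;> simp [hG0, hG1, hG2] <;> ring
  · simp only [dotProduct, Fin.sum_univ_three, hq, hG0, hG1, hG2, Pi.add_apply, Pi.smul_apply,
      smul_eq_mul]
    ring
  · obtain ⟨i, hi⟩ := hsm x hx h0
    exact hi (congrFun hG i)

/-- The linear substitution `X i ↦ ∑ j, M i j * X j`. -/
def linSubst (M : Matrix (Fin 3) (Fin 3) K) : MvPolynomial (Fin 3) K →ₐ[K] MvPolynomial (Fin 3) K :=
  aeval fun i => ∑ j, C (M i j) * X j

theorem linSubst_X (M : Matrix (Fin 3) (Fin 3) K) (i : Fin 3) :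
    linSubst M (X i) = ∑ j, C (M i j) * X j := aeval_X _ _

theorem linSubst_linSubst {M N : Matrix (Fin 3) (Fin 3) K} (h : N * M = 1)
    (F : MvPolynomial (Fin 3) K) : linSubst M (linSubst N F) = F := by
  suffices (linSubst M).comp (linSubst N) = AlgHom.id K _ from DFunLike.congr_fun this F
  ext1 i
  simp only [AlgHom.comp_apply, linSubst_X, map_sum, map_mul, AlgHom.id_apply]
  simp only [← algebraMap_eq, AlgHom.commutes, Finset.mul_sum]
  rw [Finset.sum_comm]
  simp only [algebraMap_eq, ← mul_assoc, ← C_mul, ← Finset.sum_mul, ← map_sum, ← mul_apply, h]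
  simp [one_apply]

theorem lineRestrict_linSubst (M : Matrix (Fin 3) (Fin 3) K) (y : Fin 3 → K)
    (F : MvPolynomial (Fin 3) K) :
    lineRestrict y (linSubst M F) = lineRestrict (M *ᵥ y) F := by
  suffices (lineRestrict y).comp (linSubst M) = lineRestrict (M *ᵥ y) from
    DFunLike.congr_fun this F
  ext1 i
  simp only [AlgHom.comp_apply, linSubst_X, map_sum, map_mul, lineRestrict_X]
  simp only [← algebraMap_eq, AlgHom.commutes, mulVec, dotProduct, map_sum, map_mul,
    Finset.sum_mul, Polynomial.algebraMap_eq, mul_assoc]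

theorem eval_linSubst (M : Matrix (Fin 3) (Fin 3) K) (y : Fin 3 → K)
    (F : MvPolynomial (Fin 3) K) : eval y (linSubst M F) = eval (M *ᵥ y) F := by
  rw [← eval_one_lineRestrict, lineRestrict_linSubst, eval_one_lineRestrict]

theorem constantCoeff_linSubst (M : Matrix (Fin 3) (Fin 3) K) (F : MvPolynomial (Fin 3) K) :
    constantCoeff (linSubst M F) = constantCoeff F := by
  rw [← eval_zero, eval_linSubst, mulVec_zero, eval_zero]

/-- A smooth conic with two distinct points is parametrized by binary quadratic forms. -/
theorem exists_conic_parametrization [IsAlgClosed K] {Q : MvPolynomial (Fin 3) K}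
    (hQ : Q.IsHomogeneous 2)
    (hsm : ∀ p : Fin 3 → K, p ≠ 0 → eval p Q = 0 → ∃ i, eval p (pderiv i Q) ≠ 0)
    {p p' : Fin 3 → K} (hp0 : p ≠ 0) (hpp' : ∀ c : K, p' ≠ c • p) (hp : eval p Q = 0)
    (hp' : eval p' Q = 0) :
    ∃ φ : MvPolynomial (Fin 3) K →ₐ[K] MvPolynomial (Fin 2) K,
      (∀ F, φ F = 0 → Q ∣ F) ∧ (∀ F, IsEvenPoly (φ F)) ∧
      (∀ g, IsEvenPoly g → ∃ F, φ F = g) ∧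
      (∀ F, constantCoeff (φ F) = constantCoeff F) ∧
      ∀ z : Fin 3 → K, z ≠ 0 → eval z Q = 0 → ∃ v : Fin 2 → K, v ≠ 0 ∧
        ∀ F, lineRestrict v (φ F) = 0 ↔ lineRestrict z F = 0 := by
  obtain ⟨M, k, hM, hk, hMQ⟩ := exists_conic_matrix hQ hsm hp0 hpp' hp hp'
  have hMN : M * M⁻¹ = 1 := M.mul_nonsing_inv (isUnit_iff_ne_zero.2 hM)
  have hNM : M⁻¹ * M = 1 := M.nonsing_inv_mul (isUnit_iff_ne_zero.2 hM)
  have : Infinite K := IsAlgClosed.instInfinite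
  have hQM : linSubst M Q = C k * (X 0 * X 2 - X 1 ^ 2) := by
    refine MvPolynomial.funext fun y => ?_
    rw [eval_linSubst, hMQ]
    simp
  refine ⟨veronese.comp (linSubst M), fun F hF => ?_, fun F => isEvenPoly_veronese _,
    fun g hg => ?_, fun F => ?_, fun z hz hzQ => ?_⟩
  · have hd : linSubst M Q ∣ linSubst M F := by
      rw [hQM, ((isUnit_iff_ne_zero.2 hk).map C).mul_left_dvd]
      exact dvd_of_veronese_eq_zero hF
    have := map_dvd (linSubst M⁻¹) hd
    rwa [linSubst_linSubst hMN, linSubst_linSubst hMN] at this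
  · obtain ⟨F, rfl⟩ := exists_veronese_eq hg
    exact ⟨linSubst M⁻¹ F, by rw [AlgHom.comp_apply, linSubst_linSubst hNM]⟩
  · rw [AlgHom.comp_apply, constantCoeff_veronese, constantCoeff_linSubst]
  · have hMz : M *ᵥ (M⁻¹ *ᵥ z) = z := by rw [mulVec_mulVec, hMN, one_mulVec]
    have hz' : (M⁻¹ *ᵥ z) 0 * (M⁻¹ *ᵥ z) 2 = (M⁻¹ *ᵥ z) 1 ^ 2 := by
      have := hMQ (M⁻¹ *ᵥ z)
      rw [hMz, hzQ] at this
      exact sub_eq_zero.1 ((mul_eq_zero.1 this.symm).resolve_left hk)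
    obtain ⟨v, hv⟩ := exists_param_of_mem_conic _ hz'
    refine ⟨v, ?_, fun F => ?_⟩
    · rintro rfl
      apply hz
      rw [← hMz, hv]
      ext i
      simp [mulVec, dotProduct, Fin.sum_univ_three]
    · rw [AlgHom.comp_apply, lineRestrict_veronese, ← hv, lineRestrict_linSubst, hMz,
        Polynomial.expand_eq_zero two_pos]

end NormalForm

section SymbolicPowers

variable {K : Type*} [Field K]

theorem exists_eq_smul_of_homVanishingIdeal_le {σ : Type*} {p q : σ → K} (hp : p ≠ 0)
    (hq : q ≠ 0) (h : homVanishingIdeal q ≤ homVanishingIdeal p) : ∃ c : K, p = c • q := by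
  obtain ⟨j, hj⟩ := Function.ne_iff.1 hq
  refine ⟨p j / q j, funext fun i => ?_⟩
  have hmem : C (q j) * X i - C (q i) * X j ∈ homVanishingIdeal q := by
    rw [(homVanishingIdeal_eq_ker q hj).2]
    exact Ideal.subset_span ⟨i, rfl⟩
  have h0 := eval_eq_zero_of_mem_homVanishingIdeal hp (h hmem)
  simp only [map_sub, map_mul, eval_C, eval_X] at h0
  have hj' : q j ≠ 0 := hj
  rw [Pi.smul_apply, smul_eq_mul]
  field_simp
  linear_combination h0

theorem mem_symbPow {σ ι : Type*} {P : ι → σ → K} {m : ℕ} {F : MvPolynomial σ K} :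
    F ∈ symbPow P m ↔ ∀ i, F ∈ homVanishingIdeal (P i) ^ m := by
  simp only [symbPow, Ideal.mem_iInf]

variable {ι : Type*} {P : ι → Fin 3 → K} {V : ι → Fin 2 → K}
  {φ : MvPolynomial (Fin 3) K →ₐ[K] MvPolynomial (Fin 2) K} {Q : MvPolynomial (Fin 3) K}

theorem pointForm_dvd_map_iff {p : Fin 3 → K} {v : Fin 2 → K} (hp : p ≠ 0) (hv : v ≠ 0)
    (h : ∀ F, lineRestrict v (φ F) = 0 ↔ lineRestrict p F = 0) (F : MvPolynomial (Fin 3) K) :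
    pointForm v ∣ φ F ↔ F ∈ homVanishingIdeal p := by
  rw [pointForm_dvd_iff hv, h, mem_homVanishingIdeal_iff hp]

theorem mem_symbPow_of_mul_mem (hP : ∀ i, P i ≠ 0) (hQ0 : ∀ i, Q ∈ homVanishingIdeal (P i))
    (hQ2 : ∀ i, Q ∉ homVanishingIdeal (P i) ^ 2) {m : ℕ} {S : MvPolynomial (Fin 3) K}
    (h : Q * S ∈ symbPow P (m + 1)) : S ∈ symbPow P m :=
  mem_symbPow.2 fun i => mem_pow_of_mul_mem_pow_succ (hP i) (hQ2 i) (hQ0 i) (mem_symbPow.1 h i)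

theorem mul_pow_mem_symbPow {H T : MvPolynomial (Fin 3) K} (hH : H ∈ symbPow P 2) {e : ℕ}
    (hT : T ∈ symbPow P e) (r : ℕ) : H ^ r * T ∈ symbPow P (2 * r + e) :=
  mem_symbPow.2 fun i => by
    rw [pow_add, pow_mul]
    exact Ideal.mul_mem_mul (Ideal.pow_mem_pow (mem_symbPow.1 hH i) r) (mem_symbPow.1 hT i)

variable [Fintype ι]

/-- Elements of a symbolic power restrict to multiples of the power of the equation of the
points on the parametrized curve. -/
theorem prod_pointForm_pow_dvd (hP : ProjectivelyDistinct P) (hV : ∀ i, V i ≠ 0)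
    (hφV : ∀ i F, lineRestrict (V i) (φ F) = 0 ↔ lineRestrict (P i) F = 0) {m : ℕ}
    {F : MvPolynomial (Fin 3) K} (hF : F ∈ symbPow P m) :
    (∏ i, pointForm (V i)) ^ m ∣ φ F := by
  have hd := fun i => pointForm_dvd_map_iff (hP.1 i) (hV i) (hφV i)
  rw [← Finset.prod_pow]
  refine Finset.prod_dvd_of_isRelPrime (fun i _ j _ hij => ?_) fun i _ => ?_
  · refine IsRelPrime.pow ((prime_pointForm (hV i)).irreducible.isRelPrime_iff_not_dvd.2 ?_)
    intro hdvd
    obtain ⟨c, hc⟩ := exists_eq_smul_of_homVanishingIdeal_le (hP.1 i) (hP.1 j)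
      fun G hG => (hd i G).1 (hdvd.trans ((hd j G).2 hG))
    exact hP.2 hij c hc
  · have hle : (homVanishingIdeal (P i)).map φ ≤ Ideal.span {pointForm (V i)} :=
      Ideal.map_le_iff_le_comap.2 fun G hG =>
        Ideal.mem_comap.2 (Ideal.mem_span_singleton.2 ((hd i G).2 hG))
    have := Ideal.mem_map_of_mem φ (mem_symbPow.1 hF i)
    rw [Ideal.map_pow] at this
    have := Ideal.pow_right_mono hle m this
    rwa [Ideal.span_singleton_pow, Ideal.mem_span_singleton] at this

/-- A form that doubles the points, obtained from a cyclic product of secant lines. -/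
theorem exists_double_form (hP : ProjectivelyDistinct P) (hV : ∀ i, V i ≠ 0)
    (hφV : ∀ i F, lineRestrict (V i) (φ F) = 0 ↔ lineRestrict (P i) F = 0)
    (hsurj : ∀ g, IsEvenPoly g → ∃ F, φ F = g)
    (hcc : ∀ F, constantCoeff (φ F) = constantCoeff F)
    (σ : Equiv.Perm ι) (hσ : ∀ i, σ i ≠ i) (i₀ : ι) :
    ∃ H, H ∈ symbPow P 2 ∧ H ∈ irrel K (Fin 3) * symbPow P 1 ∧
      φ H = (∏ i, pointForm (V i)) ^ 2 := by
  classical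
  have hd := fun i => pointForm_dvd_map_iff (hP.1 i) (hV i) (hφV i)
  choose L hL using fun i => hsurj _ (isEvenPoly_pointForm_mul (V i) (V (σ i)))
  have hL1 : ∀ i, L i ∈ homVanishingIdeal (P i) := fun i =>
    (hd i _).1 (hL i ▸ dvd_mul_right _ _)
  have hL2 : ∀ i, L i ∈ homVanishingIdeal (P (σ i)) := fun i =>
    (hd (σ i) _).1 (hL i ▸ dvd_mul_left _ _)
  have hL2' : ∀ i, L (σ.symm i) ∈ homVanishingIdeal (P i) := fun i => by
    simpa using hL2 (σ.symm i)
  have hσ' : ∀ i, σ.symm i ≠ i := fun i h => hσ i (by rw [← h]; simpa using h.symm)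
  refine ⟨∏ i, L i, mem_symbPow.2 fun i => ?_, ?_, ?_⟩
  · rw [← Finset.mul_prod_erase _ _ (Finset.mem_univ i),
      ← Finset.mul_prod_erase _ _ (Finset.mem_erase.2 ⟨hσ' i, Finset.mem_univ _⟩), ← mul_assoc,
      pow_two]
    exact Ideal.mul_mem_right _ _ (Ideal.mul_mem_mul (hL1 i) (hL2' i))
  · rw [← Finset.mul_prod_erase _ _ (Finset.mem_univ i₀)]
    refine Ideal.mul_mem_mul (mem_irrel_of_constantCoeff_eq_zero ?_) (mem_symbPow.2 fun i => ?_)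
    · rw [← hcc, hL]
      simp [pointForm]
    · rw [pow_one]
      rcases eq_or_ne i i₀ with rfl | hi
      · exact Ideal.mem_of_dvd _ (Finset.dvd_prod_of_mem _
          (Finset.mem_erase.2 ⟨hσ' i, Finset.mem_univ _⟩)) (hL2' i)
      · exact Ideal.mem_of_dvd _ (Finset.dvd_prod_of_mem _
          (Finset.mem_erase.2 ⟨hi, Finset.mem_univ _⟩)) (hL1 i)
  · simp only [map_prod, hL, Finset.prod_mul_distrib, pow_two]
    rw [Equiv.prod_comp σ fun i => pointForm (V i)]

/-- Division of a symbolic power by powers of a double form, modulo the conic. -/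
theorem exists_eq_pow_mul_add (hP : ProjectivelyDistinct P) (hV : ∀ i, V i ≠ 0)
    (hφV : ∀ i F, lineRestrict (V i) (φ F) = 0 ↔ lineRestrict (P i) F = 0)
    (hker : ∀ F, φ F = 0 → Q ∣ F) (heven : ∀ F, IsEvenPoly (φ F))
    (hsurj : ∀ g, IsEvenPoly g → ∃ F, φ F = g)
    (hQ0 : ∀ i, Q ∈ homVanishingIdeal (P i)) (hQ2 : ∀ i, Q ∉ homVanishingIdeal (P i) ^ 2)
    {H : MvPolynomial (Fin 3) K} (hH : H ∈ symbPow P 2)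
    (hφH : φ H = (∏ i, pointForm (V i)) ^ 2) {r e m : ℕ} (he : e ≤ 1) (hm : m + 1 = 2 * r + e)
    {T : MvPolynomial (Fin 3) K} (hT : T ∈ symbPow P (m + 1)) :
    ∃ A ∈ symbPow P e, ∃ S ∈ symbPow P m, T = H ^ r * A + Q * S := by
  have hd := fun i => pointForm_dvd_map_iff (hP.1 i) (hV i) (hφV i)
  have hD0 : ∏ i, pointForm (V i) ≠ 0 :=
    Finset.prod_ne_zero_iff.2 fun i _ => (prime_pointForm (hV i)).ne_zero
  obtain ⟨g, hg⟩ := prod_pointForm_pow_dvd hP hV hφV (hm ▸ hT)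
  rw [pow_add, pow_mul, ← hφH, ← map_pow, mul_assoc] at hg
  have hH0 : φ (H ^ r) ≠ 0 := by
    rw [map_pow, hφH]; exact pow_ne_zero _ (pow_ne_zero _ hD0)
  obtain ⟨A, hA⟩ := hsurj _ ((heven (H ^ r)).of_mul_left hH0 (hg ▸ heven T))
  have hAe : A ∈ symbPow P e := by
    refine mem_symbPow.2 fun i => ?_
    obtain rfl | rfl : e = 0 ∨ e = 1 := by omega
    · simp
    · rw [pow_one, ← hd i, hA, pow_one]
      exact (Finset.dvd_prod_of_mem _ (Finset.mem_univ i)).mul_right _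
  obtain ⟨S, hS⟩ := hker (T - H ^ r * A) (by rw [map_sub, map_mul, hA, hg, sub_self])
  refine ⟨A, hAe, S, mem_symbPow_of_mul_mem hP.1 hQ0 hQ2 ?_, by rw [← hS]; ring⟩
  rw [← hS]
  exact sub_mem hT (hm ▸ mul_pow_mem_symbPow hH hAe r)

theorem symbPow_odd_le (hP : ProjectivelyDistinct P) (hV : ∀ i, V i ≠ 0)
    (hφV : ∀ i F, lineRestrict (V i) (φ F) = 0 ↔ lineRestrict (P i) F = 0)
    (hker : ∀ F, φ F = 0 → Q ∣ F) (heven : ∀ F, IsEvenPoly (φ F))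
    (hsurj : ∀ g, IsEvenPoly g → ∃ F, φ F = g)
    (hQ0 : ∀ i, Q ∈ homVanishingIdeal (P i)) (hQ2 : ∀ i, Q ∉ homVanishingIdeal (P i) ^ 2)
    (hQM : Q ∈ irrel K (Fin 3))
    {H : MvPolynomial (Fin 3) K} (hH : H ∈ symbPow P 2) (hHM : H ∈ irrel K (Fin 3) * symbPow P 1)
    (hφH : φ H = (∏ i, pointForm (V i)) ^ 2) (k : ℕ) :
    symbPow P (2 * k + 1) ≤ irrel K (Fin 3) ^ k * symbPow P 1 ^ (k + 1) := by
  induction k with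
  | zero => simp
  | succ k ih =>
    intro T hT
    have hQI : Q ∈ symbPow P 1 := mem_symbPow.2 fun i => by rw [pow_one]; exact hQ0 i
    obtain ⟨A, hA, S, hS, rfl⟩ := exists_eq_pow_mul_add hP hV hφV hker heven hsurj hQ0 hQ2 hH hφH
      (r := k + 1) (e := 1) (m := 2 * (k + 1)) le_rfl rfl hT
    obtain ⟨B, -, S', hS', rfl⟩ := exists_eq_pow_mul_add hP hV hφV hker heven hsurj hQ0 hQ2 hH hφH
      (r := k + 1) (e := 0) (m := 2 * k + 1) zero_le_one (by ring) hS
    have hsplit : H ^ (k + 1) * A + Q * (H ^ (k + 1) * B + Q * S') =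
        H ^ (k + 1) * (A + Q * B) + Q * Q * S' := by ring
    rw [hsplit]
    refine add_mem ?_ ?_
    · have := Ideal.mul_mem_mul (Ideal.pow_mem_pow hHM (k + 1))
        (add_mem hA (Ideal.mul_mem_right B _ hQI))
      rwa [mul_pow, mul_assoc, ← pow_succ] at this
    · have := Ideal.mul_mem_mul (Ideal.mul_mem_mul hQM hQI) (ih hS')
      rwa [mul_mul_mul_comm, ← pow_succ', ← pow_succ'] at this

end SymbolicPowers

/-- For the radical ideal of an odd number `n ≥ 5` of distinct points on a
smooth plane conic, `I^{(2r-1)} ⊆ M^{r-1} I^r` for every `r ≥ 1`. -/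
theorem stmt9 {K : Type*} [Field K] [IsAlgClosed K]
    {n : ℕ} (hn : 5 ≤ n) (hodd : Odd n)
    (Q : MvPolynomial (Fin 3) K) (hQdeg : Q.IsHomogeneous 2) (hQ0 : Q ≠ 0)
    (hsm : ∀ p : Fin 3 → K, p ≠ 0 → MvPolynomial.eval p Q = 0 →
      ∃ i, MvPolynomial.eval p (MvPolynomial.pderiv i Q) ≠ 0)
    (P : Fin n → (Fin 3 → K)) (hP : ProjectivelyDistinct P)
    (honC : ∀ i, MvPolynomial.eval (P i) Q = 0)
    (r : ℕ) (hr : 1 ≤ r) :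
    symbPow P (2 * r - 1) ≤ irrel K (Fin 3) ^ (r - 1) * symbPow P 1 ^ r := by
  obtain ⟨k, rfl⟩ : ∃ k, r = k + 1 := ⟨r - 1, by omega⟩
  obtain ⟨N, rfl⟩ : ∃ N, n = N + 2 := ⟨n - 2, by omega⟩
  obtain ⟨φ, hker, heven, hsurj, hcc, hpar⟩ := exists_conic_parametrization hQdeg hsm (hP.1 0)
    (hP.2 (show (1 : Fin (N + 2)) ≠ 0 by simp)) (honC 0) (honC 1)
  choose V hV hφV using fun i => hpar (P i) (hP.1 i) (honC i)
  have hQ1 : ∀ i, Q ∈ homVanishingIdeal (P i) := fun i =>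
    Ideal.subset_span ⟨⟨2, hQdeg⟩, honC i⟩
  have hQ2 : ∀ i, Q ∉ homVanishingIdeal (P i) ^ 2 := fun i hi => by
    obtain ⟨j, hj⟩ := hsm (P i) (hP.1 i) (honC i)
    exact hj (eval_eq_zero_of_mem_homVanishingIdeal (hP.1 i) (pderiv_mem_of_mem_sq hi j))
  have hQM : Q ∈ irrel K (Fin 3) := mem_irrel_of_constantCoeff_eq_zero (by
    rw [constantCoeff_eq]; exact hQdeg.coeff_eq_zero (by simp))
  obtain ⟨H, hH, hHM, hφH⟩ := exists_double_form hP hV hφV hsurj hcc (finRotate (N + 2))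
    (fun i => by rw [finRotate_apply]; simp) 0
  exact symbPow_odd_le hP hV hφV hker heven hsurj hQ1 hQ2 hQM hH hHM hφH k
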